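/- For every ε ∈ (0,1) there exist positive constants d₀(ε) and D₀(ε) such that every n-vertex Δ-critical simple graph G with minimum degree at least d₀ and maximum degree Δ at least D₀ satisfies α(G) < (1/2 + ε)·n, where α(G) is the independence number of G. -/

import Mathlib

open Finset

variable {V : Type*}

/-- `φ` is a proper edge coloring of `G` with colors in `{1, …, k}`, encoded as a symmetric
function on ordered pairs of vertices: every edge receives a color in `[1,k]` and two distinct
edges sharing a vertex receive different colors. -/
def IsEdgeColoring (G : SimpleGraph V) (k : ℕ) (φ : V → V → ℕ) : Prop :=
  (∀ u v, φ u v = φ v u) ∧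
  (∀ ⦃u v⦄, G.Adj u v → φ u v ∈ Finset.Icc 1 k) ∧
  (∀ ⦃v a b⦄, G.Adj v a → G.Adj v b → a ≠ b → φ v a ≠ φ v b)

/-- The chromatic index of `G`: the least `k` such that `G` has a proper edge `k`-coloring. -/
noncomputable def chromIndex (G : SimpleGraph V) : ℕ :=
  sInf {k | ∃ φ : V → V → ℕ, IsEdgeColoring G k φ}

/-- `G` is `Δ`-critical: `G` is connected, `χ'(G) = Δ + 1`, and `χ'(G - e) = Δ` for every
edge `e` of `G`, where `Δ` is the maximum degree of `G`. -/
def IsDeltaCritical [Fintype V] (G : SimpleGraph V) [DecidableRel G.Adj] : Prop :=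
  G.Connected ∧ chromIndex G = G.maxDegree + 1 ∧
    ∀ e ∈ G.edgeSet, chromIndex (G.deleteEdges {e}) = G.maxDegree

/-- The independence number of `G`. -/
noncomputable def indepNum [Fintype V] (G : SimpleGraph V) : ℕ :=
  sSup {n | ∃ s : Finset V, (∀ u ∈ s, ∀ v ∈ s, u ≠ v → ¬ G.Adj u v) ∧ s.card = n}

namespace Crit
variable {V : Type*}

structure PC (G : SimpleGraph V) (k : ℕ) (φ : V → V → ℕ) : Prop where
  symm : ∀ u v, φ u v = φ v u
  adj : ∀ u v, φ u v ≠ 0 → G.Adj u v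
  le : ∀ u v, φ u v ≤ k
  inj : ∀ v a b, φ v a ≠ 0 → φ v a = φ v b → a = b

def Miss (φ : V → V → ℕ) (v : V) (a : ℕ) : Prop := ∀ u, φ v u ≠ a

def FullEx (G : SimpleGraph V) (φ : V → V → ℕ) (x y : V) : Prop :=
  ∀ u v, G.Adj u v → φ u v = 0 → (u = x ∧ v = y) ∨ (u = y ∧ v = x)

def NC (G : SimpleGraph V) (k : ℕ) : Prop :=
  ∀ φ : V → V → ℕ, PC G k φ → ¬ ∀ u v, G.Adj u v → φ u v ≠ 0

/-- the Kempe graph -/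
def K (φ : V → V → ℕ) (a b : ℕ) : SimpleGraph V :=
  SimpleGraph.fromRel (fun p q => φ p q = a ∨ φ p q = b)

lemma K_adj {G : SimpleGraph V} {k : ℕ} {φ : V → V → ℕ} (h : PC G k φ) {a b : ℕ}
    (ha : a ≠ 0) (hb : b ≠ 0) (u v : V) : (K φ a b).Adj u v ↔ φ u v = a ∨ φ u v = b := by
  unfold K
  rw [SimpleGraph.fromRel_adj, h.symm v u]
  constructor
  · grind
  · intro h1
    have : φ u v ≠ 0 := by grind
    exact ⟨(h.adj u v this).ne, Or.inl h1⟩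

lemma K_congr {φ ψ : V → V → ℕ} {a b : ℕ}
    (h : ∀ u v, (φ u v = a ↔ ψ u v = a) ∧ (φ u v = b ↔ ψ u v = b)) : K φ a b = K ψ a b := by
  unfold K
  congr 1
  funext u v
  rw [(h u v).1, (h u v).2]

lemma three_ends [Finite V] {G : SimpleGraph V} {k : ℕ} {φ : V → V → ℕ} (h : PC G k φ) {a b : ℕ}
    (ha : a ≠ 0) (hb : b ≠ 0) {x y z : V} (hxy : x ≠ y) (hxz : x ≠ z) (hyz : y ≠ z)
    (hx : Miss φ x a ∨ Miss φ x b) (hy : Miss φ y a ∨ Miss φ y b) (hz : Miss φ z a ∨ Miss φ z b)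
    (r1 : (K φ a b).Reachable x y) (r2 : (K φ a b).Reachable x z) : False := by
  classical
  have := Fintype.ofFinite V
  set H := K φ a b with hH
  set C := H.connectedComponentMk x with hC
  have hconn := C.connected_toSimpleGraph
  have h1 := hconn.card_vert_le_card_edgeSet_add_one
  have h2 := C.toSimpleGraph.sum_degrees_eq_twice_card_edges
  have hadj : ∀ p q, H.Adj p q ↔ φ p q = a ∨ φ p q = b := fun p q => K_adj h ha hb p q
  have hinj : ∀ v p q, H.Adj v p → H.Adj v q → φ v p = φ v q → p = q := by
    intro v p q hp hq he
    rw [hadj] at hp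
    exact h.inj v p q (by grind) he
  have hdeg : ∀ v : C, C.toSimpleGraph.degree v ≤ 2 ∧
      ((Miss φ v a ∨ Miss φ v b) → C.toSimpleGraph.degree v ≤ 1) := by
    intro v
    have e : ∀ S : Finset ℕ, (∀ p, H.Adj v p → φ v p ∈ S) → C.toSimpleGraph.degree v ≤ S.card := by
      intro S hS
      rw [← SimpleGraph.card_neighborFinset_eq_degree]
      apply Finset.card_le_card_of_injOn (fun p : C => φ v p)
      · intro p hp
        simp at hp
        exact hS _ hp
      · intro p hp q hq he
        simp at hp hq
        exact Subtype.ext (hinj _ _ _ hp hq he)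
    constructor
    · refine (e {a, b} ?_).trans Finset.card_le_two
      intro p hp
      rw [hadj] at hp
      simpa using hp
    · rintro (hm | hm)
      · refine (e {b} ?_).trans (by simp)
        intro p hp
        rw [hadj] at hp
        have := hm p
        simp; tauto
      · refine (e {a} ?_).trans (by simp)
        intro p hp
        rw [hadj] at hp
        have := hm p
        simp; tauto
  have mx : x ∈ C.supp := by simp [hC]
  have my : y ∈ C.supp := by simp [hC]; exact r1.symm
  have mz : z ∈ C.supp := by simp [hC]; exact r2.symm
  set T : Finset C := {⟨x, mx⟩, ⟨y, my⟩, ⟨z, mz⟩} with hT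
  have hTc : T.card = 3 := by
    rw [hT, Finset.card_eq_three]
    exact ⟨_, _, _, by simpa using hxy, by simpa using hxz, by simpa using hyz, rfl⟩
  have hs : ∑ v : C, (C.toSimpleGraph.degree v + if v ∈ T then 1 else 0) ≤ ∑ v : C, 2 := by
    apply Finset.sum_le_sum
    intro v _
    have := hdeg v
    split_ifs with hv
    · have : C.toSimpleGraph.degree v ≤ 1 := by
        apply this.2
        simp only [hT, Finset.mem_insert, Finset.mem_singleton] at hv
        rcases hv with rfl | rfl | rfl <;> assumption
      omega
    · omega
  rw [Finset.sum_add_distrib, h2] at hs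
  simp at hs
  rw [hTc] at hs
  rw [Nat.card_eq_fintype_card] at h1
  have h3 : Nat.card C.toSimpleGraph.edgeSet = C.toSimpleGraph.edgeFinset.card := by
    rw [Nat.card_eq_fintype_card, SimpleGraph.edgeFinset_card]
  have h4 : Fintype.card C = Nat.card C := by rw [Nat.card_eq_fintype_card]
  omega

open Classical in
noncomputable def sw (φ : V → V → ℕ) (a b : ℕ) (X : Set V) (u v : V) : ℕ :=
  if u ∈ X then (if φ u v = a then b else if φ u v = b then a else φ u v) else φ u v

def Cl (φ : V → V → ℕ) (a b : ℕ) (X : Set V) : Prop :=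
  ∀ u v, (φ u v = a ∨ φ u v = b) → (u ∈ X ↔ v ∈ X)

lemma sw_PC {G : SimpleGraph V} {k : ℕ} {φ : V → V → ℕ} (h : PC G k φ) {a b : ℕ}
    (ha : a ≠ 0) (hb : b ≠ 0) (ha' : a ≤ k) (hb' : b ≤ k) {X : Set V} (hX : Cl φ a b X) :
    PC G k (sw φ a b X) := by
  constructor
  · intro u v
    have := h.symm u v
    have := hX u v
    unfold sw
    grind
  · intro u v
    have := h.adj u v
    unfold sw
    grind
  · intro u v
    have := h.le u v
    unfold sw
    grind
  · intro v p q
    have := h.inj v p q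
    unfold sw
    grind

lemma sw_zero {φ : V → V → ℕ} {a b : ℕ} (ha : a ≠ 0) (hb : b ≠ 0) {X : Set V} (u v : V) :
    sw φ a b X u v = 0 ↔ φ u v = 0 := by
  unfold sw; grind

lemma sw_full {G : SimpleGraph V} {φ : V → V → ℕ} {x y : V} (h : FullEx G φ x y) {a b : ℕ}
    (ha : a ≠ 0) (hb : b ≠ 0) {X : Set V} : FullEx G (sw φ a b X) x y := by
  intro u v h1 h2
  rw [sw_zero ha hb] at h2
  exact h u v h1 h2

lemma sw_other {φ : V → V → ℕ} {a b p : ℕ} {X : Set V} (ha : p ≠ a) (hb : p ≠ b) (u v : V) :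
    sw φ a b X u v = p ↔ φ u v = p := by
  unfold sw; grind

lemma sw_nmem {φ : V → V → ℕ} {a b : ℕ} {X : Set V} {u : V} (hu : u ∉ X) (v : V) :
    sw φ a b X u v = φ u v := by
  unfold sw; grind

lemma sw_miss_other {φ : V → V → ℕ} {a b p : ℕ} {X : Set V} (ha : p ≠ a) (hb : p ≠ b) (u : V) :
    Miss (sw φ a b X) u p ↔ Miss φ u p := by
  unfold Miss; simp only [ne_eq, sw_other ha hb]

lemma sw_miss_nmem {φ : V → V → ℕ} {a b p : ℕ} {X : Set V} {u : V} (hu : u ∉ X) :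
    Miss (sw φ a b X) u p ↔ Miss φ u p := by
  unfold Miss; simp only [sw_nmem hu]

lemma sw_miss_left {φ : V → V → ℕ} {a b : ℕ} {X : Set V} {u : V} (hu : u ∈ X)
    (h : Miss φ u b) : Miss (sw φ a b X) u a := by
  intro v
  have := h v
  unfold sw; grind

def comp (φ : V → V → ℕ) (a b : ℕ) (x : V) : Set V := {v | (K φ a b).Reachable x v}

lemma comp_self (φ : V → V → ℕ) (a b : ℕ) (x : V) : x ∈ comp φ a b x :=
  SimpleGraph.Reachable.refl x

lemma comp_Cl {G : SimpleGraph V} {k : ℕ} {φ : V → V → ℕ} (h : PC G k φ) {a b : ℕ}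
    (ha : a ≠ 0) (hb : b ≠ 0) (x : V) : Cl φ a b (comp φ a b x) := by
  intro u v huv
  rw [← K_adj h ha hb] at huv
  exact ⟨fun h => h.trans huv.reachable, fun h => h.trans huv.reachable.symm⟩

lemma Cl_compl {φ : V → V → ℕ} {a b : ℕ} {X : Set V} (h : Cl φ a b X) : Cl φ a b Xᶜ := by
  intro u v huv
  have := h u v huv
  simp only [Set.mem_compl_iff]; tauto

open Classical in
noncomputable def upd (φ : V → V → ℕ) (u v : V) (a : ℕ) (p q : V) : ℕ :=
  if (p = u ∧ q = v) ∨ (p = v ∧ q = u) then a else φ p q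

lemma upd_PC {G : SimpleGraph V} {k : ℕ} {φ : V → V → ℕ} (h : PC G k φ) {u v : V} {a : ℕ}
    (huv : G.Adj u v) (ha' : a ≤ k) (h1 : a = 0 ∨ Miss φ u a ∧ Miss φ v a) :
    PC G k (upd φ u v a) := by
  have hne := huv.ne
  constructor
  · intro p q
    have := h.symm p q
    unfold upd
    grind
  · intro p q
    have := h.adj p q
    have := huv.symm
    unfold upd
    grind
  · intro u v
    have := h.le u v
    unfold upd
    grind
  · intro s p q
    have := h.inj s p q
    unfold Miss at h1
    unfold upd
    grind

lemma final_recolor {G : SimpleGraph V} {k : ℕ} {φ : V → V → ℕ} (hN : NC G k) (h : PC G k φ)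
    {x y w u v : V} {a c c1 : ℕ} (hF : FullEx G φ x y) (hxy : G.Adj x y)
    (hwy : w ≠ y) (hux : u ≠ x) (huv : u ≠ v) (hvx : v ≠ x) (huw : u ≠ w) (hvy : v ≠ y)
    (hc : c ≠ 0) (ha : a ≠ 0) (hc1 : c1 ≠ 0) (hc1k : c1 ≤ k)
    (hxw : φ x w = c) (hyu : φ y u = c) (hwv : φ w v = a) (m1 : Miss φ x a) (m2 : Miss φ v c)
    (m3 : Miss φ u c1) (m4 : Miss φ y c1) : False := by
  have axw : G.Adj x w := h.adj _ _ (by grind)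
  have ayu : G.Adj y u := h.adj _ _ (by grind)
  have awv : G.Adj w v := h.adj _ _ (by grind)
  have hak : a ≤ k := by have := h.le w v; omega
  have hck : c ≤ k := by have := h.le x w; omega
  have nxy := hxy.ne
  have nxw := axw.ne
  have nyu := ayu.ne
  have nwv := awv.ne
  unfold Miss at *
  have uq : ∀ q, φ y q = c → q = u := fun q hq => h.inj y q u (by grind) (by grind)
  have xq : ∀ q, φ x q = c → q = w := fun q hq => h.inj x q w (by grind) (by grind)
  have wq : ∀ q, φ w q = c → q = x := fun q hq => h.inj w q x (by grind) (by grind [h.symm x w])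
  have wq' : ∀ q, φ w q = a → q = v := fun q hq => h.inj w q v (by grind) (by grind)
  have p1 := upd_PC h ayu hc1k (Or.inr ⟨m4, m3⟩)
  have p2 := upd_PC p1 awv (Nat.zero_le k) (Or.inl rfl)
  have p3 := upd_PC p2 axw hak (Or.inr ⟨by unfold Miss upd; grind, by unfold Miss upd; grind⟩)
  have p4 := upd_PC p3 hxy hck (Or.inr ⟨by unfold Miss upd; grind, by unfold Miss upd; grind⟩)
  have p5 := upd_PC p4 awv hck (Or.inr ⟨by unfold Miss upd; grind, by unfold Miss upd; grind⟩)
  refine hN _ p5 ?_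
  intro p q hpq
  have := hF p q hpq
  unfold upd
  grind

end Crit

namespace Crit
variable {V : Type*}

/-- Two low neighbours of `y` joined by colours missing at `x` have disjoint missing sets. -/
lemma fan_disj [Finite V] {G : SimpleGraph V} {k : ℕ} {φ : V → V → ℕ} (hN : NC G k) (h : PC G k φ)
    {x y u u' : V} {c1 b : ℕ} (hF : FullEx G φ x y) (hxy : G.Adj x y)
    (huu : u ≠ u') (hux : u ≠ x) (hux' : u' ≠ x) (hc1 : c1 ≠ 0) (hc1k : c1 ≤ k)
    (hb : b ≠ 0) (hbk : b ≤ k) (m4 : Miss φ y c1)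
    (h0 : φ y u ≠ 0) (h0' : φ y u' ≠ 0)
    (m1 : Miss φ x (φ y u)) (m1' : Miss φ x (φ y u')) (m2 : Miss φ u b) (m2' : Miss φ u' b) :
    False := by
  have key : ∀ u, u ≠ x → φ y u ≠ 0 → Miss φ x (φ y u) → Miss φ u b →
      y ∉ comp φ c1 b u → False := by
    intro u hux h0 m1 m2 hy
    have p1 := sw_PC h hc1 hb hc1k hbk (comp_Cl h hc1 hb u)
    have f1 := sw_full hF hc1 hb (X := comp φ c1 b u)
    have n1 : φ y u ≠ c1 := m4 u
    have n2 : φ y u ≠ b := by rw [h.symm]; exact m2 y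
    have e1 : sw φ c1 b (comp φ c1 b u) y u = φ y u := sw_nmem hy u
    have q1 : Miss (sw φ c1 b (comp φ c1 b u)) u c1 := sw_miss_left (comp_self _ _ _ _) m2
    have q2 : Miss (sw φ c1 b (comp φ c1 b u)) y c1 := (sw_miss_nmem hy).2 m4
    have q3 : Miss (sw φ c1 b (comp φ c1 b u)) x (φ y u) := (sw_miss_other n1 n2 _).2 m1
    have ayu := h.adj _ _ h0
    have hck := h.le y u
    generalize sw φ c1 b (comp φ c1 b u) = ψ at *
    have nxy := hxy.ne
    have nyu := ayu.ne
    have yq : ∀ q, ψ y q = φ y u → q = u := fun q hq => p1.inj y q u (by grind) (by grind)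
    have p2 := upd_PC p1 ayu hc1k (Or.inr ⟨q2, q1⟩)
    unfold Miss at q3
    have p3 := upd_PC p2 hxy hck (Or.inr ⟨by unfold Miss upd; grind, by unfold Miss upd; grind⟩)
    refine hN _ p3 ?_
    intro p q hpq
    have := f1 p q hpq
    unfold upd
    grind
  by_cases hy : y ∈ comp φ c1 b u
  · refine key u' hux' h0' m1' m2' ?_
    intro hy'
    have r1 : (K φ c1 b).Reachable u y := hy
    have r2 : (K φ c1 b).Reachable u' y := hy'
    exact three_ends h hc1 hb huu (h.adj _ _ h0).ne' (h.adj _ _ h0').ne' (Or.inr m2) (Or.inr m2')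
      (Or.inl m4) (r1.trans r2.symm) r1
  · exact key u hux h0 m1 m2 hy

lemma core [Finite V] {G : SimpleGraph V} {k : ℕ} {φ : V → V → ℕ} (hN : NC G k) (h : PC G k φ)
    {x y w u v : V} {a b0 b1 c g c1 : ℕ} (hF : FullEx G φ x y) (hxy : G.Adj x y)
    (hwy : w ≠ y) (hux : u ≠ x) (huv : u ≠ v) (hvx : v ≠ x) (huw : u ≠ w) (hvy : v ≠ y)
    (hc : c ≠ 0) (ha : a ≠ 0) (hc1 : c1 ≠ 0) (hg : g ≠ 0) (hb0 : b0 ≠ 0) (hb1 : b1 ≠ 0)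
    (hak : a ≤ k) (hc1k : c1 ≤ k) (hb0k : b0 ≤ k) (hb1k : b1 ≤ k)
    (hxw : φ x w = c) (hyu : φ y u = c) (hwv : φ w v = g)
    (m1 : Miss φ x a) (m2 : Miss φ v a) (m3 : Miss φ v b1) (m4 : Miss φ y c1) (m5 : Miss φ u b0)
    (n1 : a ≠ c1) (n2 : b0 ≠ a) (n3 : b1 ≠ a) (n4 : b1 ≠ c1) (n5 : b1 ≠ b0)
    (n6 : c ≠ b0) (n7 : g ≠ c1) (n8 : g ≠ b0)
    (l1 : y ∉ comp φ c1 b0 u) (l2 : x ∉ comp φ c b1 v) (l3 : y ∉ comp φ c b1 v)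
    (l4 : x ∉ comp φ g a v) : False := by
  have hck : c ≤ k := by have := h.le x w; omega
  have hgk : g ≤ k := by have := h.le w v; omega
  have nca : c ≠ a := by rw [← hxw]; exact m1 w
  have ncc1 : c ≠ c1 := by rw [← hyu]; exact m4 u
  have ngb1 : g ≠ b1 := by rw [← hwv, h.symm]; exact m3 w
  have nga : g ≠ a := by rw [← hwv, h.symm]; exact m2 w
  have ngc : g ≠ c := by
    intro e
    have := h.inj w v x (by omega) (by rw [h.symm w x]; omega)
    exact hvx this
  -- first swap
  obtain ⟨φ2, h2, hF2, hxw2, hyu2, hwv2, a1, a2, a3, a4, a5, K1, K2⟩ : ∃ φ2, PC G k φ2 ∧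
      FullEx G φ2 x y ∧ φ2 x w = c ∧ φ2 y u = c ∧ φ2 w v = g ∧ Miss φ2 x a ∧ Miss φ2 v a ∧
      Miss φ2 v b1 ∧ Miss φ2 y c1 ∧ Miss φ2 u c1 ∧ K φ2 c b1 = K φ c b1 ∧ K φ2 g a = K φ g a := by
    refine ⟨sw φ c1 b0 (comp φ c1 b0 u), sw_PC h hc1 hb0 hc1k hb0k (comp_Cl h hc1 hb0 u),
      sw_full hF hc1 hb0, (sw_other ncc1 n6 _ _).2 hxw, (sw_other ncc1 n6 _ _).2 hyu,
      (sw_other n7 n8 _ _).2 hwv, (sw_miss_other n1 n2.symm _).2 m1,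
      (sw_miss_other n1 n2.symm _).2 m2, (sw_miss_other n4 n5 _).2 m3, (sw_miss_nmem l1).2 m4,
      sw_miss_left (comp_self _ _ _ _) m5,
      K_congr fun p q => ⟨sw_other ncc1 n6 p q, sw_other n4 n5 p q⟩,
      K_congr fun p q => ⟨sw_other n7 n8 p q, sw_other n1 n2.symm p q⟩⟩
  have l2' : x ∉ comp φ2 c b1 v := by unfold comp; rw [K1]; exact l2
  have l3' : y ∉ comp φ2 c b1 v := by unfold comp; rw [K1]; exact l3
  have l4' : x ∉ comp φ2 g a v := by unfold comp; rw [K2]; exact l4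
  -- second swap
  obtain ⟨φ3, h3, hF3, hxw3, hyu3, hwv3, d1, d2, d3, d4, d5, K3⟩ : ∃ φ3, PC G k φ3 ∧
      FullEx G φ3 x y ∧ φ3 x w = c ∧ φ3 y u = c ∧ φ3 w v = g ∧ Miss φ3 x a ∧ Miss φ3 v a ∧
      Miss φ3 v c ∧ Miss φ3 y c1 ∧ Miss φ3 u c1 ∧ K φ3 g a = K φ2 g a := by
    refine ⟨sw φ2 c b1 (comp φ2 c b1 v), sw_PC h2 hc hb1 hck hb1k (comp_Cl h2 hc hb1 v),
      sw_full hF2 hc hb1, (sw_nmem l2' _).trans hxw2, (sw_nmem l3' _).trans hyu2,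
      (sw_other ngc ngb1 _ _).2 hwv2, (sw_miss_nmem l2').2 a1,
      (sw_miss_other nca.symm n3.symm _).2 a2, sw_miss_left (comp_self _ _ _ _) a3,
      (sw_miss_nmem l3').2 a4,
      (sw_miss_other ncc1.symm n4.symm _).2 a5,
      K_congr fun p q => ⟨sw_other ngc ngb1 p q, sw_other nca.symm n3.symm p q⟩⟩
  have l4'' : x ∉ comp φ3 g a v := by unfold comp; rw [K3]; exact l4'
  have ew : sw φ3 g a (comp φ3 g a v) w v = a := by
    have : w ∈ comp φ3 g a v := by
      refine ((comp_Cl h3 hg ha v) v w ?_).1 (comp_self _ _ _ _)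
      left; rw [h3.symm]; exact hwv3
    unfold sw; rw [if_pos this, if_pos hwv3]
  exact final_recolor hN (sw_PC h3 hg ha hgk hak (comp_Cl h3 hg ha v)) (sw_full hF3 hg ha) hxy
    hwy hux huv hvx huw hvy hc ha hc1 hc1k ((sw_nmem l4'' _).trans hxw3)
    ((sw_other ngc.symm nca _ _).2 hyu3) ew ((sw_miss_nmem l4'').2 d1)
    ((sw_miss_other ngc.symm nca _).2 d3) ((sw_miss_other n7.symm n1.symm _).2 d5)
    ((sw_miss_other n7.symm n1.symm _).2 d4)

end Crit

namespace Crit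
variable {V : Type*}

open Classical in
noncomputable def ms (k : ℕ) (φ : V → V → ℕ) (v : V) : Finset ℕ :=
  (Finset.Icc 1 k).filter (fun b => Miss φ v b)

lemma mem_ms {k : ℕ} {φ : V → V → ℕ} {v : V} {b : ℕ} :
    b ∈ ms k φ v ↔ (1 ≤ b ∧ b ≤ k) ∧ Miss φ v b := by
  simp [ms]

lemma ms_card [Fintype V] {G : SimpleGraph V} [DecidableRel G.Adj] {k : ℕ} {φ : V → V → ℕ}
    (h : PC G k φ) (v : V) : k ≤ (ms k φ v).card + G.degree v := by
  classical
  have h1 : Finset.Icc 1 k \ (G.neighborFinset v).image (φ v) ⊆ ms k φ v := by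
    intro b hb
    simp only [mem_sdiff, mem_Icc, mem_image, SimpleGraph.mem_neighborFinset] at hb
    rw [mem_ms]
    refine ⟨hb.1, fun u hu => hb.2 ⟨u, h.adj v u (by omega), hu⟩⟩
  have h2 := Finset.card_le_card h1
  have h3 := Finset.le_card_sdiff ((G.neighborFinset v).image (φ v)) (Finset.Icc 1 k)
  have h4 : ((G.neighborFinset v).image (φ v)).card ≤ G.degree v := Finset.card_image_le
  simp at h3
  omega

lemma ms_real [Fintype V] {G : SimpleGraph V} [DecidableRel G.Adj] {k : ℕ} {φ : V → V → ℕ}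
    (h : PC G k φ) (v : V) {δ : ℝ} (hv : (G.degree v : ℝ) ≤ (1 - δ) * k) :
    δ * k ≤ (ms k φ v).card := by
  have := ms_card h v
  have : (k : ℝ) ≤ (ms k φ v).card + G.degree v := by exact_mod_cast this
  linarith

/-- `y` misses a colour since one edge at `y` is uncoloured. -/
lemma ms_end [Fintype V] {G : SimpleGraph V} [DecidableRel G.Adj] {k : ℕ} {φ : V → V → ℕ}
    (h : PC G k φ) {x y : V} (hxy : G.Adj x y) (h0 : φ x y = 0) (hk : G.degree y ≤ k) :
    ∃ c, c ≠ 0 ∧ c ≤ k ∧ Miss φ y c := by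
  classical
  have h4 : (((G.neighborFinset y).erase x).image (φ y)).card < k := by
    refine lt_of_le_of_lt Finset.card_image_le ?_
    rw [Finset.card_erase_of_mem (by simpa using hxy.symm)]
    have : 0 < G.degree y := by
      rw [SimpleGraph.degree_pos_iff_exists_adj]; exact ⟨x, hxy.symm⟩
    simp only [SimpleGraph.card_neighborFinset_eq_degree]
    omega
  have h5 : ((Finset.Icc 1 k) \ (((G.neighborFinset y).erase x).image (φ y))).Nonempty := by
    rw [← Finset.card_pos]
    have h3 := Finset.le_card_sdiff (((G.neighborFinset y).erase x).image (φ y)) (Finset.Icc 1 k)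
    rw [Nat.card_Icc] at h3
    omega
  obtain ⟨c, hc⟩ := h5
  simp only [mem_sdiff, mem_Icc, mem_image, mem_erase, SimpleGraph.mem_neighborFinset] at hc
  refine ⟨c, by omega, by omega, fun u hu => hc.2 ⟨u, ⟨?_, h.adj _ _ (by omega)⟩, hu⟩⟩
  rintro rfl
  rw [h.symm] at hu
  omega

lemma averaging {α : Type*} (P : Finset α) (f : α → Finset ℕ) (k : ℕ) (δ : ℝ)
    (hδk : 6 ≤ δ * k) (hf : ∀ p ∈ P, f p ⊆ Finset.Icc 1 k) (hc : ∀ p ∈ P, δ * k ≤ (f p).card)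
    (E : Finset ℕ) (hE : E.card ≤ 3) (hδ : 0 < δ) (hδ1 : δ ≤ 1) :
    ∃ b, 1 ≤ b ∧ b ≤ k ∧ b ∉ E ∧ δ / 2 * P.card ≤ (P.filter (fun p => b ∈ f p)).card := by
  have hk : (0:ℝ) < k := by
    by_contra hh
    nlinarith
  have hk6 : (6:ℝ) ≤ k := by nlinarith
  have hk6' : 6 ≤ k := by exact_mod_cast hk6
  set S := Finset.Icc 1 k \ E with hS
  have hSk : S.card ≤ k := (Finset.card_le_card Finset.sdiff_subset).trans (by simp)
  have hSne : S.Nonempty := by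
    rw [← Finset.card_pos]
    have h3 := Finset.le_card_sdiff E (Finset.Icc 1 k)
    simp at h3
    rw [hS]
    omega
  have hsum : ∑ b ∈ S, (P.filter (fun p => b ∈ f p)).card = ∑ p ∈ P, (S.filter (fun b => b ∈ f p)).card := by
    exact (Finset.sum_card_bipartiteAbove_eq_sum_card_bipartiteBelow (fun b p => b ∈ f p))
  have hlow : ∀ p ∈ P, δ / 2 * k ≤ ((S.filter (fun b => b ∈ f p)).card : ℝ) := by
    intro p hp
    have h1 : f p \ E ⊆ S.filter (fun b => b ∈ f p) := by
      intro b hb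
      simp only [mem_sdiff, mem_filter, hS] at hb ⊢
      exact ⟨⟨hf p hp hb.1, hb.2⟩, hb.1⟩
    have h2 := Finset.card_le_card h1
    have h3 := Finset.le_card_sdiff E (f p)
    have h4 : (f p).card ≤ (S.filter (fun b => b ∈ f p)).card + 3 := by omega
    have h5 : ((f p).card : ℝ) ≤ (S.filter (fun b => b ∈ f p)).card + 3 := by exact_mod_cast h4
    have := hc p hp
    linarith
  by_contra hcon
  push Not at hcon
  have h1 : (∑ b ∈ S, ((P.filter (fun p => b ∈ f p)).card : ℝ)) < ∑ b ∈ S, δ / 2 * P.card := by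
    apply Finset.sum_lt_sum_of_nonempty hSne
    intro b hb
    simp only [hS, mem_sdiff, mem_Icc] at hb
    exact hcon b hb.1.1 hb.1.2 hb.2
  have h2 : ∑ p ∈ P, δ / 2 * (k : ℝ) ≤ ∑ p ∈ P, ((S.filter (fun b => b ∈ f p)).card : ℝ) :=
    Finset.sum_le_sum hlow
  have h3 : (∑ b ∈ S, ((P.filter (fun p => b ∈ f p)).card : ℝ)) =
    ∑ p ∈ P, ((S.filter (fun b => b ∈ f p)).card : ℝ) := by exact_mod_cast hsum
  simp only [sum_const, nsmul_eq_mul] at h1 h2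
  have h4 : (S.card : ℝ) ≤ k := by exact_mod_cast hSk
  have h5 : (0:ℝ) ≤ δ / 2 * P.card := by positivity
  nlinarith

lemma fiber_bound [DecidableEq V] (S : Finset (V × V)) (W : Finset V) (t : ℕ)
    (hS : ∀ p ∈ S, p.1 ∈ W)
    (h : ∀ w ∈ W, (S.filter (fun p => p.1 = w)).card ≤ t) : S.card ≤ t * W.card :=
  Finset.card_le_mul_card_image_of_maps_to hS t h

end Crit

namespace Crit
variable {V : Type*}

lemma ms_sub (D : ℕ) (φ : V → V → ℕ) (v : V) : ms D φ v ⊆ Finset.Icc 1 D := by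
  intro b hb
  exact mem_Icc.2 (mem_ms.1 hb).1

lemma same_first [DecidableEq V] (P S : Finset (V × V)) (k : ℕ) (hSP : S ⊆ P)
    (hfib : ∀ w, (P.filter (fun p => p.1 = w)).card ≤ k)
    (h : ∀ p ∈ S, ∀ q ∈ S, p.1 = q.1) : S.card ≤ k := by
  rcases S.eq_empty_or_nonempty with rfl | ⟨p, hp⟩
  · simp
  · refine (Finset.card_le_card ?_).trans (hfib p.1)
    intro q hq
    exact mem_filter.2 ⟨hSP hq, h q hq p hp⟩

/-- A vertex in a common Kempe component, other than the base vertex, is not isolated. -/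
lemma comp_col {G : SimpleGraph V} {k : ℕ} {φ : V → V → ℕ} (h : PC G k φ) {g a : ℕ}
    (hg : g ≠ 0) (ha : a ≠ 0) {x v : V} (hvx : v ≠ x) (hx : x ∈ comp φ g a v)
    (m : Miss φ x a) : ∃ z, φ x z = g := by
  have hr : (K φ g a).Reachable x v := SimpleGraph.Reachable.symm hx
  obtain ⟨p⟩ := hr
  cases p with
  | nil => exact absurd rfl hvx
  | cons hadj _ =>
    rw [K_adj h hg ha] at hadj
    rcases hadj with e | e
    · exact ⟨_, e⟩
    · exact absurd e (m _)

lemma counts_core [Fintype V] [DecidableEq V] {G : SimpleGraph V} [DecidableRel G.Adj] {D : ℕ}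
    {φ : V → V → ℕ}
    (hN : NC G D) (h : PC G D φ) {x y : V} (hF : FullEx G φ x y) (hxy : G.Adj x y)
    (L : Finset V) (hL : ∀ u ∈ L, ∀ v ∈ L, ¬ G.Adj u v) (hxL : x ∈ L) {δ : ℝ} (hδ : 0 < δ)
    (hδ1 : δ ≤ 1) (hδD : 6 ≤ δ * D) (hlow : ∀ v ∈ L, (G.degree v : ℝ) ≤ (1 - δ) * D)
    {a c1 : ℕ} (ha : a ≠ 0) (haD : a ≤ D) (hc1 : c1 ≠ 0) (hc1D : c1 ≤ D) (m1 : Miss φ x a)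
    (m4 : Miss φ y c1) (n1 : a ≠ c1) (u : V → V)
    (P : Finset (V × V))
    (hP : ∀ p ∈ P, p.1 ≠ y ∧ G.Adj p.1 p.2 ∧ p.2 ∈ L ∧ p.2 ≠ x ∧ p.2 ≠ u p.1 ∧ u p.1 ∈ L ∧
      u p.1 ≠ x ∧ φ x p.1 ≠ 0 ∧ φ y (u p.1) = φ x p.1 ∧ Miss φ p.2 a)
    (hfib : ∀ w, (P.filter (fun p => p.1 = w)).card ≤ G.degree x) :
    (δ / 2) ^ 2 * P.card ≤ 9 * G.degree x := by
  classical
  set k := G.degree x with hk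
  obtain ⟨b1, hb1, hb1D, hb1E, hb1P⟩ := averaging P (fun p => ms D φ p.2) D δ hδD
    (fun p _ => ms_sub _ _ _) (fun p hp => ms_real h _ (hlow _ (hP p hp).2.2.1))
    {a, c1} (Finset.card_le_two.trans (by norm_num)) hδ hδ1
  set P1 := P.filter (fun p => b1 ∈ ms D φ p.2) with hP1
  obtain ⟨b0, hb0, hb0D, hb0E, hb0P⟩ := averaging P1 (fun p => ms D φ (u p.1)) D δ hδD
    (fun p _ => ms_sub _ _ _)
    (fun p hp => ms_real h _ (hlow _ (hP p (mem_filter.1 hp).1).2.2.2.2.2.1))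
    {a, c1, b1} Finset.card_le_three hδ hδ1
  set Q := P1.filter (fun p => b0 ∈ ms D φ (u p.1)) with hQ
  simp only [mem_insert, mem_singleton, not_or] at hb1E hb0E
  have hQP : ∀ p ∈ Q, p ∈ P := fun p hp => (mem_filter.1 (mem_filter.1 hp).1).1
  have hm3 : ∀ p ∈ Q, Miss φ p.2 b1 := fun p hp =>
    (mem_ms.1 (mem_filter.1 (mem_filter.1 hp).1).2).2
  have hm5 : ∀ p ∈ Q, Miss φ (u p.1) b0 := fun p hp => (mem_ms.1 (mem_filter.1 hp).2).2
  have hQsub : Q ⊆ P := hQP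
  have hyL : y ∉ L := fun hy => hL _ hxL _ hy hxy
  have hW : ∀ p ∈ Q, p.1 ∈ G.neighborFinset x := fun p hp => by
    rw [SimpleGraph.mem_neighborFinset]
    exact h.adj _ _ (hP p (hQP p hp)).2.2.2.2.2.2.2.1
  have hWc : (G.neighborFinset x).card = k := SimpleGraph.card_neighborFinset_eq_degree _ _
  have hgne : ∀ p ∈ Q, φ p.1 p.2 ≠ 0 := by
    intro p hp e
    have hp' := hP p (hQP p hp)
    rcases hF _ _ hp'.2.1 e with e | e
    · exact hyL (e.2 ▸ hp'.2.2.1)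
    · exact hp'.1 e.1
  have cover : ∀ p ∈ Q, φ x p.1 = b0 ∨ φ p.1 p.2 = c1 ∨ φ p.1 p.2 = b0 ∨
      y ∈ comp φ c1 b0 (u p.1) ∨ x ∈ comp φ (φ x p.1) b1 p.2 ∨ y ∈ comp φ (φ x p.1) b1 p.2 ∨
      x ∈ comp φ (φ p.1 p.2) a p.2 := by
    intro p hp
    by_contra hcon
    simp only [not_or] at hcon
    obtain ⟨i1, i2, i3, i4, i5, i6, i7⟩ := hcon
    obtain ⟨q1, q2, q3, q4, q5, q6, q7, q8, q9, q10⟩ := hP p (hQP p hp)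
    refine core hN h hF hxy (w := p.1) (u := u p.1) (v := p.2) q1 q7 (Ne.symm q5) q4 ?_ ?_
      q8 ha hc1 (hgne p hp) (by omega) (by omega) haD hc1D hb0D hb1D rfl q9 rfl m1 q10
      (hm3 p hp) m4 (hm5 p hp) n1 hb0E.1 hb1E.1 hb1E.2 (Ne.symm hb0E.2.2) i1 i2 i3 i4 i5 i6 i7
    · intro e
      have hh := h.adj _ _ q8
      rw [← e] at hh
      exact hL _ hxL _ q6 hh
    · intro e
      exact hyL (e ▸ q3)
  have c1' : (Q.filter (fun p => φ x p.1 = b0)).card ≤ k := by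
    refine same_first P _ k ((filter_subset _ _).trans hQsub) hfib ?_
    intro p hp q hq
    rw [mem_filter] at hp hq
    exact h.inj x _ _ (hP p (hQP p hp.1)).2.2.2.2.2.2.2.1 (hp.2.trans hq.2.symm)
  have cg : ∀ e : ℕ, (Q.filter (fun p => φ p.1 p.2 = e)).card ≤ 1 * k := by
    intro e
    rw [← hWc]
    refine fiber_bound _ _ 1 (fun p hp => hW p (mem_filter.1 hp).1) ?_
    intro w _
    rw [card_le_one]
    intro p hp q hq
    simp only [mem_filter] at hp hq
    have := h.inj w p.2 q.2 (by rw [← hp.2]; exact hgne p hp.1.1)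
      (by have h1 := hp.1.2; have h2 := hq.1.2; rw [hp.2] at h1; rw [hq.2] at h2; omega)
    exact Prod.ext (hp.2.trans hq.2.symm) this
  have c4 : (Q.filter (fun p => y ∈ comp φ c1 b0 (u p.1))).card ≤ k := by
    refine same_first P _ k ((filter_subset _ _).trans hQsub) hfib ?_
    intro p hp q hq
    rw [mem_filter] at hp hq
    have hp' := hP p (hQP p hp.1)
    have hq' := hP q (hQP q hq.1)
    have huu : u p.1 = u q.1 := by
      by_contra hne
      exact three_ends h hc1 (by omega : b0 ≠ 0)
        (x := y) (y := u p.1) (z := u q.1) (fun e => hyL (e ▸ hp'.2.2.2.2.2.1))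
        (fun e => hyL (e ▸ hq'.2.2.2.2.2.1)) hne (Or.inl m4) (Or.inr (hm5 p hp.1))
        (Or.inr (hm5 q hq.1)) (SimpleGraph.Reachable.symm hp.2) (SimpleGraph.Reachable.symm hq.2)
    refine h.inj x _ _ hp'.2.2.2.2.2.2.2.1 ?_
    rw [← hp'.2.2.2.2.2.2.2.2.1, ← hq'.2.2.2.2.2.2.2.2.1, huu]
  have cz : ∀ z : V, (Q.filter (fun p => z ∈ comp φ (φ x p.1) b1 p.2)).card ≤ 2 * k := by
    intro z
    rw [← hWc]
    refine fiber_bound _ _ 2 (fun p hp => hW p (mem_filter.1 hp).1) ?_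
    intro w _
    by_contra hcon
    rw [not_le, Finset.two_lt_card] at hcon
    obtain ⟨p, hp, q, hq, r, hr, hpq, hpr, hqr⟩ := hcon
    simp only [mem_filter] at hp hq hr
    have e1 := hp.1.2
    have e2 := hq.1.2
    have e3 := hr.1.2
    have hc0 := (hP p (hQP p hp.1.1)).2.2.2.2.2.2.2.1
    rw [hp.2] at e1 hc0
    rw [hq.2] at e2
    rw [hr.2] at e3
    exact three_ends h hc0 (by omega : b1 ≠ 0)
        (x := p.2) (y := q.2) (z := r.2) (fun e => hpq (Prod.ext (hp.2.trans hq.2.symm) e))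
        (fun e => hpr (Prod.ext (hp.2.trans hr.2.symm) e))
        (fun e => hqr (Prod.ext (hq.2.trans hr.2.symm) e))
        (Or.inr (hm3 _ hp.1.1)) (Or.inr (hm3 _ hq.1.1)) (Or.inr (hm3 _ hr.1.1))
        (SimpleGraph.Reachable.trans e1 (SimpleGraph.Reachable.symm e2))
        (SimpleGraph.Reachable.trans e1 (SimpleGraph.Reachable.symm e3))
  have c7 : (Q.filter (fun p => x ∈ comp φ (φ p.1 p.2) a p.2)).card ≤ k := by
    rw [← hWc]
    refine le_trans ?_ (Finset.card_image_le (f := φ x))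
    refine Finset.card_le_card_of_injOn (fun p => φ p.1 p.2) ?_ ?_
    · intro p hp
      simp only [coe_filter, Set.mem_ofPred_eq] at hp
      have hp' := hP p (hQP p hp.1)
      obtain ⟨z, hz⟩ := comp_col h (hgne p hp.1) ha hp'.2.2.2.1 hp.2 m1
      simp only [coe_image, Set.mem_image, mem_coe, SimpleGraph.mem_neighborFinset]
      refine ⟨z, h.adj _ _ ?_, hz⟩
      rw [hz]; exact hgne p hp.1
    · intro p hp q hq e
      simp only [coe_filter, Set.mem_ofPred_eq] at hp hq
      have e' : φ p.1 p.2 = φ q.1 q.2 := e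
      have hp' := hP p (hQP p hp.1)
      have hq' := hP q (hQP q hq.1)
      have hv : p.2 = q.2 := by
        by_contra hne
        have r2 := hq.2
        rw [← e'] at r2
        exact three_ends h (hgne p hp.1) ha (x := x) (y := p.2) (z := q.2)
          (Ne.symm hp'.2.2.2.1) (Ne.symm hq'.2.2.2.1) hne (Or.inr m1)
          (Or.inr hp'.2.2.2.2.2.2.2.2.2) (Or.inr hq'.2.2.2.2.2.2.2.2.2)
          (SimpleGraph.Reachable.symm hp.2) (SimpleGraph.Reachable.symm r2)
      refine Prod.ext ?_ hv
      refine h.inj p.2 _ _ ?_ ?_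
      · rw [h.symm]; exact hgne p hp.1
      · rw [h.symm, e', h.symm q.1, hv]
  have hQ9 : Q.card ≤ 9 * k := by
    have hsub : Q ⊆ Q.filter (fun p => φ x p.1 = b0) ∪ (Q.filter (fun p => φ p.1 p.2 = c1) ∪
        (Q.filter (fun p => φ p.1 p.2 = b0) ∪ (Q.filter (fun p => y ∈ comp φ c1 b0 (u p.1)) ∪
        (Q.filter (fun p => x ∈ comp φ (φ x p.1) b1 p.2) ∪
        (Q.filter (fun p => y ∈ comp φ (φ x p.1) b1 p.2) ∪
        Q.filter (fun p => x ∈ comp φ (φ p.1 p.2) a p.2)))))) := by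
      intro p hp
      simp only [mem_union, mem_filter, hp, true_and]
      exact cover p hp
    have hle := Finset.card_le_card hsub
    have u1 := fun s t : Finset (V × V) => Finset.card_union_le s t
    refine hle.trans ((u1 _ _).trans ?_)
    have g1 := cg c1
    have g2 := cg b0
    have z1 := cz x
    have z2 := cz y
    refine (Nat.add_le_add c1' ((u1 _ _).trans (Nat.add_le_add g1 ((u1 _ _).trans
      (Nat.add_le_add g2 ((u1 _ _).trans (Nat.add_le_add c4 ((u1 _ _).trans
      (Nat.add_le_add z1 ((u1 _ _).trans (Nat.add_le_add z2 c7))))))))))).trans ?_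
    omega
  have hQ9' : (Q.card : ℝ) ≤ 9 * k := by exact_mod_cast hQ9
  nlinarith

end Crit

namespace Crit
variable {V : Type*}

/-- The number of neighbours of `v` in `L`. -/
def q (G : SimpleGraph V) [DecidableRel G.Adj] (L : Finset V) (v : V) : ℕ :=
  (L.filter (fun u => G.Adj v u)).card

lemma bad_card [Fintype V] {G : SimpleGraph V} [DecidableRel G.Adj] {D : ℕ}
    {φ : V → V → ℕ} (hN : NC G D) (h : PC G D φ) {x y : V} (hF : FullEx G φ x y)
    (hxy : G.Adj x y) {δ : ℝ} (hD : 0 < D) {c1 : ℕ} (hc1 : c1 ≠ 0) (hc1D : c1 ≤ D)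
    (m4 : Miss φ y c1) (B : Finset V)
    (hB : ∀ u ∈ B, u ≠ x ∧ φ y u ≠ 0 ∧ Miss φ x (φ y u) ∧ (G.degree u : ℝ) ≤ (1 - δ) * D) :
    δ * B.card ≤ 1 := by
  classical
  have hdisj : ∀ u ∈ B, ∀ v ∈ B, u ≠ v → Disjoint (ms D φ u) (ms D φ v) := by
    intro u hu v hv huv
    rw [Finset.disjoint_left]
    intro b hb hb'
    rw [mem_ms] at hb hb'
    have hu' := hB u hu
    have hv' := hB v hv
    exact fan_disj hN h hF hxy huv hu'.1 hv'.1 hc1 hc1D (by omega) hb.1.2 m4 hu'.2.1 hv'.2.1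
      hu'.2.2.1 hv'.2.2.1 hb.2 hb'.2
  have h1 := Finset.card_biUnion hdisj
  have h2 : B.biUnion (fun u => ms D φ u) ⊆ Finset.Icc 1 D := by
    intro b hb
    obtain ⟨u, _, hu⟩ := mem_biUnion.1 hb
    exact ms_sub _ _ _ hu
  have h3 := Finset.card_le_card h2
  rw [h1, Nat.card_Icc] at h3
  have h4 : ((∑ u ∈ B, (ms D φ u).card : ℕ) : ℝ) ≤ D := by exact_mod_cast h3
  push_cast at h4
  have h5 : ∑ u ∈ B, δ * (D : ℝ) ≤ ∑ u ∈ B, ((ms D φ u).card : ℝ) :=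
    Finset.sum_le_sum fun u hu => ms_real h u (hB u hu).2.2.2
  simp only [sum_const, nsmul_eq_mul] at h5
  have hD' : (0:ℝ) < D := by exact_mod_cast hD
  have h6 : (δ * B.card) * D ≤ 1 * D := by nlinarith
  exact le_of_mul_le_mul_right h6 hD'

set_option maxHeartbeats 1000000 in
lemma key [Fintype V] [DecidableEq V] {G : SimpleGraph V} [DecidableRel G.Adj] {D : ℕ}
    {φ : V → V → ℕ} (hN : NC G D) (h : PC G D φ) {x y : V} (hF : FullEx G φ x y)
    (hxy : G.Adj x y) (h00 : φ x y = 0) (hyD : G.degree y ≤ D)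
    (L : Finset V) (hL : ∀ u ∈ L, ∀ v ∈ L, ¬ G.Adj u v) (hxL : x ∈ L) {δ η η' : ℝ} (hδ : 0 < δ)
    (hδ1 : δ ≤ 1) (hη : 0 < η) (hη1 : η ≤ 1) (hη' : 0 < η') (hη1' : η' ≤ 1)
    (hδD : 6 ≤ δ * D) (hlow : ∀ v ∈ L, (G.degree v : ℝ) ≤ (1 - δ) * D)
    (hk : 705 ≤ δ ^ 3 * η * η' * G.degree x) (hq : η * G.degree x < q G L y) :
    η / 2 * G.degree x ≤
      ((G.neighborFinset x).filter (fun w => (q G L w : ℝ) ≤ η' * G.degree x)).card := by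
  classical
  by_contra hcon
  rw [not_le] at hcon
  set k := G.degree x with hkdef
  have hDpos : 0 < D := by
    rcases Nat.eq_zero_or_pos D with e | e
    · rw [e] at hδD; norm_num at hδD
    · exact e
  have hyL : y ∉ L := fun hy => hL _ hxL _ hy hxy
  obtain ⟨c1, hc1, hc1D, m4⟩ := ms_end h hxy h00 hyD
  obtain ⟨a, ha'⟩ : (ms D φ x).Nonempty := by
    rw [← Finset.card_pos]
    have := ms_real h x (hlow x hxL)
    have : (0:ℝ) < (ms D φ x).card := by linarith
    exact_mod_cast this
  rw [mem_ms] at ha'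
  obtain ⟨⟨ha1, haD⟩, m1⟩ := ha'
  have ha : a ≠ 0 := by omega
  have n1 : a ≠ c1 := by
    rintro rfl
    refine hN _ (upd_PC h hxy haD (Or.inr ⟨m1, m4⟩)) ?_
    intro p r hpr
    have := hF p r hpr
    unfold upd
    grind
  set U := (L.filter (fun u => G.Adj y u)).erase x with hU
  have hUc : U.card + 1 = q G L y := by
    rw [hU, Finset.card_erase_add_one]
    · rfl
    · rw [mem_filter]; exact ⟨hxL, hxy.symm⟩
  have hUmem : ∀ u ∈ U, u ≠ x ∧ u ∈ L ∧ G.Adj y u ∧ φ y u ≠ 0 := by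
    intro u hu
    rw [hU, mem_erase, mem_filter] at hu
    refine ⟨hu.1, hu.2.1, hu.2.2, fun e => ?_⟩
    rcases hF _ _ hu.2.2 e with e | e
    · exact hxy.ne e.1.symm
    · exact hu.1 e.2
  have hbad : δ * (U.filter (fun u => Miss φ x (φ y u))).card ≤ 1 := by
    refine bad_card hN h hF hxy hDpos hc1 hc1D m4 _ ?_
    intro u hu
    rw [mem_filter] at hu
    have := hUmem u hu.1
    exact ⟨this.1, this.2.2.2, hu.2, hlow u this.2.1⟩
  set Ug := U.filter (fun u => ¬ Miss φ x (φ y u)) with hUg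
  have hUsplit : (U.filter (fun u => Miss φ x (φ y u))).card + Ug.card = U.card :=
    Finset.card_filter_add_card_filter_not _
  have hex : ∀ u, ∃ w, u ∈ Ug → φ x w = φ y u := by
    intro u
    by_cases hu : u ∈ Ug
    · have := (mem_filter.1 hu).2
      unfold Miss at this
      push Not at this
      obtain ⟨w, hw⟩ := this
      exact ⟨w, fun _ => hw⟩
    · exact ⟨x, fun h => absurd h hu⟩
  choose f hf using hex
  set W0 := Ug.image f with hW0
  have hUgm : ∀ u ∈ Ug, u ∈ U := fun u hu => (mem_filter.1 hu).1
  have hW0c : W0.card = Ug.card := by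
    refine Finset.card_image_of_injOn ?_
    intro u hu v hv e
    have e1 := hf u hu
    have e2 := hf v hv
    have e3 : f u = f v := e
    rw [e3] at e1
    exact h.inj y u v (hUmem u (hUgm u hu)).2.2.2 (e1.symm.trans e2)
  have hexg : ∀ w, ∃ u, w ∈ W0 → u ∈ Ug ∧ φ y u = φ x w := by
    intro w
    by_cases hw : w ∈ W0
    · obtain ⟨u, hu, rfl⟩ := mem_image.1 hw
      exact ⟨u, fun _ => ⟨hu, (hf u hu).symm⟩⟩
    · exact ⟨x, fun h => absurd h hw⟩
  choose g hg using hexg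
  have hW0m : ∀ w ∈ W0, φ x w ≠ 0 ∧ w ≠ y ∧ G.Adj x w ∧ g w ∈ L ∧ g w ≠ x := by
    intro w hw
    have hgw := hg w hw
    have hgU := hUmem _ (hUgm _ hgw.1)
    have h0 : φ x w ≠ 0 := by rw [← hgw.2]; exact hgU.2.2.2
    exact ⟨h0, fun e => h0 (e ▸ h00), h.adj _ _ h0, hgU.2.1, hgU.1⟩
  set W := W0.filter (fun w => η' * k < (q G L w : ℝ)) with hW
  have hWW0 : ∀ w ∈ W, w ∈ W0 := fun w hw => (mem_filter.1 hw).1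
  have hWsplit : W.card + (W0.filter (fun w => ¬ η' * k < (q G L w : ℝ))).card = W0.card :=
    Finset.card_filter_add_card_filter_not _
  have hWlow : (W0.filter (fun w => ¬ η' * k < (q G L w : ℝ))).card ≤
      ((G.neighborFinset x).filter (fun w => (q G L w : ℝ) ≤ η' * k)).card := by
    refine Finset.card_le_card ?_
    intro w hw
    rw [mem_filter] at hw ⊢
    rw [SimpleGraph.mem_neighborFinset]
    exact ⟨(hW0m w hw.1).2.2.1, not_lt.1 hw.2⟩
  have hkpos : (0:ℝ) < k := by
    by_contra hh
    have : (k:ℝ) = 0 := le_antisymm (not_lt.1 hh) (Nat.cast_nonneg _)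
    rw [this] at hk; norm_num at hk
  have hδ3 : δ ^ 3 ≤ δ := by nlinarith [sq_nonneg δ, mul_nonneg hδ.le hδ.le]
  have hA : 705 ≤ δ * (η * k) := by
    have t1 : δ ^ 3 * η * η' * k ≤ δ ^ 3 * η * 1 * k := by gcongr
    have t2 : δ ^ 3 * η * 1 * k ≤ δ * η * 1 * k := by gcongr
    linarith
  have hB : 705 ≤ η' * k := by
    have t1 : δ ^ 3 * η * η' * k ≤ 1 * 1 * η' * k := by
      gcongr
      exact pow_le_one₀ hδ.le hδ1
    linarith
  have hηk : 705 ≤ η * k := by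
    have : δ * (η * k) ≤ 1 * (η * k) := by gcongr
    linarith
  have hWc : η * k / 4 ≤ W.card := by
    have s1 : ((U.filter (fun u => Miss φ x (φ y u))).card : ℝ) + Ug.card = U.card := by
      exact_mod_cast hUsplit
    have s2 : (W.card : ℝ) + (W0.filter (fun w => ¬ η' * k < (q G L w : ℝ))).card = Ug.card := by
      rw [← hW0c]; exact_mod_cast hWsplit
    have s3 : ((W0.filter (fun w => ¬ η' * k < (q G L w : ℝ))).card : ℝ) ≤
      ((G.neighborFinset x).filter (fun w => (q G L w : ℝ) ≤ η' * k)).card := by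
      exact_mod_cast hWlow
    have s4 : (U.card : ℝ) + 1 = q G L y := by exact_mod_cast hUc
    have s5 : ((U.filter (fun u => Miss φ x (φ y u))).card : ℝ) ≤ η * k / 8 := by
      by_contra hh
      rw [not_le] at hh
      have := mul_lt_mul_of_pos_left hh hδ
      linarith
    linarith
  set s := ⌈η' * k / 2⌉₊ with hs
  have hsge : η' * k / 2 ≤ s := Nat.le_ceil _
  have hsk : s ≤ k := by
    rw [hs, Nat.ceil_le]
    nlinarith
  have hexL : ∀ w, ∃ T : Finset V, w ∈ W →
      T ⊆ (L.filter (fun v => G.Adj w v)) \ {x, g w} ∧ T.card = s := by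
    intro w
    by_cases hw : w ∈ W
    · have h1 := Finset.le_card_sdiff {x, g w} (L.filter (fun v => G.Adj w v))
      have h2 : ({x, g w} : Finset V).card ≤ 2 := Finset.card_le_two
      have h3 := (mem_filter.1 hw).2
      have h4 : (L.filter (fun v => G.Adj w v)).card ≤
        ((L.filter (fun v => G.Adj w v)) \ {x, g w}).card + 2 := by omega
      have h5 : ((L.filter (fun v => G.Adj w v)).card : ℝ) ≤
        ((L.filter (fun v => G.Adj w v)) \ {x, g w}).card + 2 := by exact_mod_cast h4
      have h6 : (q G L w : ℝ) = (L.filter (fun v => G.Adj w v)).card := rfl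
      have h7 : s ≤ ((L.filter (fun v => G.Adj w v)) \ {x, g w}).card := by
        rw [hs, Nat.ceil_le]
        linarith
      obtain ⟨T, hT, hTc⟩ := Finset.exists_subset_card_eq h7
      exact ⟨T, fun _ => ⟨hT, hTc⟩⟩
    · exact ⟨∅, fun h => absurd h hw⟩
  choose T hT using hexL
  set P0 := (W ×ˢ (Finset.univ : Finset V)).filter (fun p => p.2 ∈ T p.1) with hP0
  have hP0W : ∀ p ∈ P0, p.1 ∈ W ∧ p.2 ∈ T p.1 := by
    intro p hp
    rw [hP0, mem_filter, mem_product] at hp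
    exact ⟨hp.1.1, hp.2⟩
  have hfibeq : ∀ w ∈ W, (P0.filter (fun p => p.1 = w)).card = s := by
    intro w hw
    rw [← (hT w hw).2, ← Finset.card_image_of_injective (T w) (Prod.mk_right_injective w)]
    congr 1
    ext ⟨p1, p2⟩
    simp only [hP0, mem_filter, mem_product, mem_univ, and_true, mem_image, Prod.mk.injEq]
    grind
  have hfib0 : ∀ w, (P0.filter (fun p => p.1 = w)).card ≤ k := by
    intro w
    by_cases hw : w ∈ W
    · rw [hfibeq w hw]; exact hsk
    · rw [Finset.card_eq_zero.2]
      · exact Nat.zero_le _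
      · rw [Finset.filter_eq_empty_iff]
        intro p hp e
        exact hw (e ▸ (hP0W p hp).1)
  have hP0c : P0.card = W.card * s := by
    rw [Finset.card_eq_sum_card_fiberwise (f := Prod.fst) (t := W) (fun p hp => (hP0W p hp).1),
      Finset.sum_congr rfl hfibeq, sum_const, smul_eq_mul]
  have hP0m : ∀ p ∈ P0, p.1 ∈ W0 ∧ p.2 ∈ L ∧ G.Adj p.1 p.2 ∧ p.2 ≠ x ∧ p.2 ≠ g p.1 := by
    intro p hp
    have h1 := hP0W p hp
    have h2 := (hT _ h1.1).1 h1.2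
    simp only [mem_sdiff, mem_filter, mem_insert, mem_singleton, not_or] at h2
    exact ⟨hWW0 _ h1.1, h2.1.1, h2.1.2, h2.2.1, h2.2.2⟩
  obtain ⟨b, hb1, hbD, hbE, hbP⟩ := averaging P0 (fun p => ms D φ p.2) D δ hδD
    (fun p _ => ms_sub _ _ _) (fun p hp => ms_real h _ (hlow _ (hP0m p hp).2.1))
    {a, c1} (Finset.card_le_two.trans (by norm_num)) hδ hδ1
  simp only [mem_insert, mem_singleton, not_or] at hbE
  have hb : b ≠ 0 := by omega
  set Pb := P0.filter (fun p => b ∈ ms D φ p.2) with hPb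
  have hPbm : ∀ p ∈ Pb, p ∈ P0 ∧ Miss φ p.2 b := fun p hp =>
    ⟨(mem_filter.1 hp).1, (mem_ms.1 (mem_filter.1 hp).2).2⟩
  set X := comp φ a b x with hX
  set P1 := Pb.filter (fun p => φ x p.1 ≠ b ∧ p.2 ∉ X) with hP1
  have hxX : x ∉ Xᶜ := fun hh => hh (comp_self φ a b x)
  have r1 : (Pb.filter (fun p => φ x p.1 = b)).card ≤ k := by
    refine same_first P0 _ k ((filter_subset _ _).trans (filter_subset _ _)) hfib0 ?_
    intro p hp r hr
    rw [mem_filter] at hp hr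
    exact h.inj x _ _ (hW0m _ (hP0m p (hPbm p hp.1).1).1).1 (hp.2.trans hr.2.symm)
  have r2 : (Pb.filter (fun p => p.2 ∈ X)).card ≤ k := by
    rw [hkdef, ← SimpleGraph.card_neighborFinset_eq_degree]
    refine Finset.card_le_card_of_injOn Prod.fst ?_ ?_
    · intro p hp
      simp only [coe_filter, Set.mem_ofPred_eq] at hp
      simp only [mem_coe, SimpleGraph.mem_neighborFinset]
      exact (hW0m _ (hP0m p (hPbm p hp.1).1).1).2.2.1
    · intro p hp r hr e
      simp only [coe_filter, Set.mem_ofPred_eq] at hp hr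
      refine Prod.ext e ?_
      by_contra hne
      exact three_ends h ha hb (x := x) (y := p.2) (z := r.2)
        (Ne.symm (hP0m p (hPbm p hp.1).1).2.2.2.1) (Ne.symm (hP0m r (hPbm r hr.1).1).2.2.2.1)
        hne (Or.inl m1) (Or.inr (hPbm p hp.1).2) (Or.inr (hPbm r hr.1).2) hp.2 hr.2
  have r3 : Pb.card ≤ P1.card + 2 * k := by
    have hsub : Pb ⊆ P1 ∪ (Pb.filter (fun p => φ x p.1 = b) ∪ Pb.filter (fun p => p.2 ∈ X)) := by
      intro p hp
      simp only [hP1, mem_union, mem_filter, hp, true_and]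
      tauto
    have h1 := Finset.card_le_card hsub
    have h2 := Finset.card_union_le P1
      (Pb.filter (fun p => φ x p.1 = b) ∪ Pb.filter (fun p => p.2 ∈ X))
    have h3 := Finset.card_union_le (Pb.filter (fun p => φ x p.1 = b))
      (Pb.filter (fun p => p.2 ∈ X))
    omega
  have fin := counts_core hN (sw_PC h ha hb haD hbD (Cl_compl (comp_Cl h ha hb x)))
    (sw_full hF ha hb) hxy L hL hxL hδ hδ1 hδD hlow ha haD hc1 hc1D
    ((sw_miss_nmem hxX).2 m1) ((sw_miss_other (Ne.symm n1) (Ne.symm hbE.2) y).2 m4) n1 g P1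
    (by
      intro p hp
      rw [hP1, mem_filter] at hp
      have p0 := hP0m p (hPbm p hp.1).1
      have w0 := hW0m _ p0.1
      have eg := (hg _ p0.1).2
      have ex := sw_nmem (φ := φ) (a := a) (b := b) hxX p.1
      refine ⟨w0.2.1, p0.2.2.1, p0.2.1, p0.2.2.2.1, p0.2.2.2.2, w0.2.2.2.1, w0.2.2.2.2, ?_, ?_, ?_⟩
      · rw [ex]; exact w0.1
      · rw [ex, sw_other (m1 _) hp.2.1]; exact eg
      · exact sw_miss_left hp.2.2 (hPbm p hp.1).2)
    (fun w => (Finset.card_le_card (Finset.filter_subset_filter _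
      ((filter_subset _ _).trans (filter_subset _ _)))).trans (hfib0 w))
  have r3' : (Pb.card : ℝ) ≤ P1.card + 2 * k := by exact_mod_cast r3
  have hP0c' : (P0.card : ℝ) = W.card * s := by exact_mod_cast hP0c
  have f1 : (η * k / 4) * (η' * k / 2) ≤ W.card * s := by gcongr
  have f2 : δ / 2 * ((η * k / 4) * (η' * k / 2)) ≤ P1.card + 2 * k := by
    rw [hP0c'] at hbP
    have : δ / 2 * ((η * k / 4) * (η' * k / 2)) ≤ δ / 2 * (W.card * s) := by gcongr
    linarith
  have f3 : (δ / 2) ^ 2 * (δ / 2 * ((η * k / 4) * (η' * k / 2))) ≤ (δ / 2) ^ 2 * (P1.card + 2 * k) := by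
    gcongr
  have f4 : (δ / 2) ^ 2 * (2 * k) ≤ 1 * (2 * k) := by
    gcongr
    apply pow_le_one₀ <;> linarith
  have f5 : (δ ^ 3 * η * η' * k) * k ≤ 704 * k := by
    have e1 : (δ / 2) ^ 2 * (δ / 2 * ((η * k / 4) * (η' * k / 2))) =
      (δ ^ 3 * η * η' * k) * k / 64 := by ring
    have e2 : (δ / 2) ^ 2 * ((P1.card : ℝ) + 2 * k) =
      (δ / 2) ^ 2 * P1.card + (δ / 2) ^ 2 * (2 * k) := by ring
    rw [e1, e2] at f3
    linarith
  have f6 := le_of_mul_le_mul_right f5 hkpos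
  linarith

end Crit

namespace Crit
variable {V : Type*}

lemma discharge [Fintype V] [DecidableEq V] {G : SimpleGraph V} [DecidableRel G.Adj] {D : ℕ}
    (hdeg : ∀ v, G.degree v ≤ D) (hpos : ∀ v, 0 < G.degree v) (hD : 0 < D)
    (I : Finset V) (hI : ∀ u ∈ I, ∀ v ∈ I, ¬ G.Adj u v) {δ η η' : ℝ}
    (hδ1 : δ < 1) (hη : 0 < η) (hη' : 0 < η')
    (L : Finset V) (hL : L = I.filter (fun v => (G.degree v : ℝ) ≤ (1 - δ) * D))
    (hkey : ∀ x ∈ L, ∀ y, G.Adj x y → η * G.degree x < q G L y → η / 2 * G.degree x ≤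
      ((G.neighborFinset x).filter (fun w => (q G L w : ℝ) ≤ η' * G.degree x)).card) :
    (I.card : ℝ) ≤ (1 / (1 - δ) + (η + 2 * η' / η)) * (Iᶜ).card := by
  classical
  set C : ℝ := η + 2 * η' / η with hC
  have hCpos : 0 < C := by positivity
  set low : V → Finset V := fun x =>
    (G.neighborFinset x).filter (fun w => (q G L w : ℝ) ≤ η' * G.degree x) with hlow
  set S : V → Finset V := fun x =>
    if x ∈ L ∧ ∃ y, G.Adj x y ∧ η * G.degree x < q G L y then low x else G.neighborFinset x with hS
  have hdp : ∀ v, (0:ℝ) < G.degree v := fun v => by exact_mod_cast hpos v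
  have hδ' : 0 < 1 - δ := by linarith
  have hD' : (0:ℝ) < D := by exact_mod_cast hD
  have hSN : ∀ x, S x ⊆ G.neighborFinset x := by
    intro x
    simp only [hS]
    split_ifs
    · exact filter_subset _ _
    · exact subset_rfl
  have hSpos : ∀ x, (0:ℝ) < (S x).card := by
    intro x
    simp only [hS]
    split_ifs with hc
    · obtain ⟨hx, y, hxy, hq⟩ := hc
      have h1 := hkey x hx y hxy hq
      have := hdp x
      have h2 : 0 < η / 2 * G.degree x := by positivity
      exact lt_of_lt_of_le h2 h1
    · rw [SimpleGraph.card_neighborFinset_eq_degree]; exact hdp x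
  have hone : ∀ x ∈ I, (1:ℝ) = ∑ y ∈ Iᶜ, if y ∈ S x then 1 / ((S x).card : ℝ) else 0 := by
    intro x hx
    rw [← Finset.sum_filter]
    have : (Iᶜ).filter (fun y => y ∈ S x) = S x := by
      ext y
      simp only [mem_filter, mem_compl, and_iff_right_iff_imp]
      intro hy hyI
      exact hI x hx y hyI (by simpa using hSN x hy)
    rw [this, sum_const, nsmul_eq_mul]
    have := hSpos x
    field_simp
  have hsum : (I.card : ℝ) = ∑ y ∈ Iᶜ, ∑ x ∈ I, if y ∈ S x then 1 / ((S x).card : ℝ) else 0 := by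
    rw [Finset.sum_comm, ← Finset.sum_congr rfl hone]
    simp
  have hterm : ∀ y, ∀ x ∈ I, (if y ∈ S x then 1 / ((S x).card : ℝ) else 0) ≤
      (if x ∈ L ∧ G.Adj y x then C / q G L y else 0) +
      (if G.Adj y x then 1 / ((1 - δ) * D) else 0) := by
    intro y x hx
    by_cases hy : y ∈ S x
    · have hadj : G.Adj x y := by simpa using hSN x hy
      have hadj' := hadj.symm
      rw [if_pos hy]
      by_cases hxL : x ∈ L
      · have hqpos : (0:ℝ) < q G L y := by
          have : 0 < q G L y := Finset.card_pos.2 ⟨x, mem_filter.2 ⟨hxL, hadj'⟩⟩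
          exact_mod_cast this
        rw [if_pos ⟨hxL, hadj'⟩, if_pos hadj']
        have hk := hdp x
        have h2 : (0:ℝ) ≤ 1 / ((1 - δ) * D) := by positivity
        suffices hh : 1 / ((S x).card : ℝ) ≤ C / q G L y by linarith
        rw [div_le_div_iff₀ (hSpos x) hqpos]
        by_cases hc : x ∈ L ∧ ∃ y, G.Adj x y ∧ η * G.degree x < q G L y
        · have e : S x = low x := if_pos hc
          rw [e] at hy ⊢
          have hqy := (mem_filter.1 hy).2
          obtain ⟨_, z, hz, hqz⟩ := hc
          have h1 : η / 2 * G.degree x ≤ (low x).card := hkey x hxL z hz hqz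
          have h3 : 2 * η' / η * (η / 2 * G.degree x) ≤ 2 * η' / η * (low x).card := by gcongr
          have h4 : 2 * η' / η * (η / 2 * G.degree x) = η' * G.degree x := by
            rw [div_mul_eq_mul_div, div_eq_iff (ne_of_gt hη)]
            ring
          have h5 : 0 ≤ η * (low x).card := mul_nonneg hη.le (Nat.cast_nonneg _)
          rw [hC]
          nlinarith
        · have e : S x = G.neighborFinset x := if_neg hc
          rw [e, SimpleGraph.card_neighborFinset_eq_degree]
          push Not at hc
          have h1 := hc hxL y hadj
          have h5 : 0 ≤ 2 * η' / η * G.degree x := by positivity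
          rw [hC]
          nlinarith
      · have e : S x = G.neighborFinset x := by
          simp only [hS]; rw [if_neg (fun hc => hxL hc.1)]
        rw [e, SimpleGraph.card_neighborFinset_eq_degree, if_neg (fun hc => hxL hc.1), if_pos hadj',
          zero_add]
        have hnl : (1 - δ) * D < G.degree x := by
          by_contra hh
          exact hxL (hL ▸ mem_filter.2 ⟨hx, not_lt.1 hh⟩)
        exact one_div_le_one_div_of_le (by positivity) hnl.le
    · rw [if_neg hy]
      have : (0:ℝ) ≤ C / q G L y := by positivity
      have : (0:ℝ) ≤ 1 / ((1 - δ) * D) := by positivity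
      split_ifs <;> linarith
  have hy : ∀ y ∈ Iᶜ, (∑ x ∈ I, if y ∈ S x then 1 / ((S x).card : ℝ) else 0) ≤
      1 / (1 - δ) + C := by
    intro y _
    refine (Finset.sum_le_sum (hterm y)).trans ?_
    rw [Finset.sum_add_distrib, ← Finset.sum_filter, ← Finset.sum_filter, sum_const, sum_const,
      nsmul_eq_mul, nsmul_eq_mul]
    have h1 : I.filter (fun x => x ∈ L ∧ G.Adj y x) = L.filter (fun x => G.Adj y x) := by
      ext x
      simp only [mem_filter, hL]
      tauto
    have h2 : ((I.filter (fun x => G.Adj y x)).card : ℝ) ≤ D := by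
      have : (I.filter (fun x => G.Adj y x)).card ≤ D := by
        refine le_trans (Finset.card_le_card ?_) (hdeg y)
        intro x hx
        simpa using (mem_filter.1 hx).2
      exact_mod_cast this
    have h3 : ((L.filter (fun x => G.Adj y x)).card : ℝ) = q G L y := rfl
    rw [h1, h3]
    have h4 : (q G L y : ℝ) * (C / q G L y) ≤ C := by
      rcases eq_or_ne (q G L y : ℝ) 0 with e | e
      · rw [e]; simpa using hCpos.le
      · rw [mul_div_cancel₀ _ e]
    have h5 : ((I.filter (fun x => G.Adj y x)).card : ℝ) * (1 / ((1 - δ) * D)) ≤ 1 / (1 - δ) := by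
      calc _ ≤ (D:ℝ) * (1 / ((1 - δ) * D)) := by gcongr
        _ = _ := by field_simp
    linarith
  rw [hsum]
  refine (Finset.sum_le_sum hy).trans ?_
  rw [sum_const, nsmul_eq_mul, mul_comm]

end Crit

namespace Crit

lemma NC_of_lt {V : Type*} {G : SimpleGraph V} {k : ℕ} (h : k < chromIndex G) : NC G k := by
  intro φ hφ hfull
  refine Nat.notMem_of_lt_sInf h ?_
  refine ⟨φ, hφ.symm, ?_, ?_⟩
  · intro u v huv
    rw [mem_Icc]
    have := hfull u v huv
    exact ⟨by omega, hφ.le u v⟩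
  · intro v a b ha hb hab e
    exact hab (hφ.inj v a b (hfull v a ha) e)

lemma exists_PC {V : Type*} {G : SimpleGraph V} {k : ℕ} {x y : V}
    (hk : k ≠ 0) (h : chromIndex (G.deleteEdges {s(x, y)}) = k) :
    ∃ φ, PC G k φ ∧ FullEx G φ x y ∧ φ x y = 0 := by
  classical
  have hne : {k | ∃ φ : V → V → ℕ, IsEdgeColoring (G.deleteEdges {s(x, y)}) k φ}.Nonempty := by
    by_contra hh
    rw [Set.not_nonempty_iff_eq_empty] at hh
    unfold chromIndex at h
    rw [hh] at h
    simp at h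
    exact hk h.symm
  have hm := Nat.sInf_mem hne
  change chromIndex _ ∈ _ at hm
  rw [h] at hm
  obtain ⟨φ, h1, h2, h3⟩ := hm
  set H := G.deleteEdges {s(x, y)} with hH
  have hadj : ∀ u v, H.Adj u v ↔ G.Adj u v ∧ s(u, v) ≠ s(x, y) := by
    intro u v
    rw [hH, SimpleGraph.deleteEdges_adj]
    simp
  have hz : ∀ u v, (if H.Adj u v then φ u v else 0) ≠ 0 → H.Adj u v := by
    intro u v hh
    by_contra hc
    exact hh (if_neg hc)
  refine ⟨fun u v => if H.Adj u v then φ u v else 0, ⟨?_, ?_, ?_, ?_⟩, ?_, ?_⟩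
  · intro u v
    simp only [H.adj_comm u v, h1 u v]
  · intro u v hh
    exact ((hadj u v).1 (hz u v hh)).1
  · intro u v
    by_cases hc : H.Adj u v
    · simp only [if_pos hc]
      exact (mem_Icc.1 (h2 hc)).2
    · simp only [if_neg hc]
      exact Nat.zero_le _
  · intro v a b ha e
    have hva := hz v a ha
    have hvb := hz v b (by rw [← e]; exact ha)
    by_contra hab
    simp only [if_pos hva, if_pos hvb] at e
    exact h3 hva hvb hab e
  · intro u v huv e
    by_cases hc : H.Adj u v
    · simp only [if_pos hc] at e
      have := (mem_Icc.1 (h2 hc)).1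
      omega
    · rw [hadj] at hc
      have : s(u, v) = s(x, y) := by
        by_contra hh
        exact hc ⟨huv, hh⟩
      rwa [Sym2.eq_iff] at this
  · have : ¬ H.Adj x y := by rw [hadj]; simp
    simp only [if_neg this]

lemma indepNum_attained {V : Type*} [Fintype V] (G : SimpleGraph V) :
    ∃ s : Finset V, (∀ u ∈ s, ∀ v ∈ s, ¬ G.Adj u v) ∧ s.card = indepNum G := by
  have hm : indepNum G ∈
      {n | ∃ s : Finset V, (∀ u ∈ s, ∀ v ∈ s, u ≠ v → ¬ G.Adj u v) ∧ s.card = n} := by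
    refine Nat.sSup_mem ⟨0, ∅, by simp, by simp⟩ ⟨Fintype.card V, ?_⟩
    rintro n ⟨s, _, rfl⟩
    exact Finset.card_le_univ s
  obtain ⟨s, hs, hc⟩ := hm
  exact ⟨s, fun u hu v hv huv => hs u hu v hv huv.ne huv, hc⟩

end Crit

/-- For every `ε ∈ (0,1)` there exist positive constants `d₀(ε)` and `D₀(ε)` such that every
`n`-vertex `Δ`-critical simple graph `G` with minimum degree at least `d₀` and maximum degree
`Δ` at least `D₀` satisfies `α(G) < (1/2 + ε) n`. -/
theorem statement0 (ε : ℝ) (hε : ε ∈ Set.Ioo (0 : ℝ) 1) :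
    ∃ d₀ D₀ : ℝ, 0 < d₀ ∧ 0 < D₀ ∧
      ∀ (V : Type) [Fintype V] (G : SimpleGraph V) [DecidableRel G.Adj],
        IsDeltaCritical G → (∀ v : V, d₀ ≤ (G.degree v : ℝ)) →
        D₀ ≤ (G.maxDegree : ℝ) →
        (indepNum G : ℝ) < (1 / 2 + ε) * (Fintype.card V : ℝ) := by
  obtain ⟨hε0, hε1⟩ := hε
  obtain ⟨δ, hδ⟩ : ∃ δ, δ = ε / 4 := ⟨_, rfl⟩
  obtain ⟨η', hη'⟩ : ∃ η', η' = ε ^ 2 / 32 := ⟨_, rfl⟩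
  have hδ0 : 0 < δ := by rw [hδ]; positivity
  have hδ1 : δ < 1 := by rw [hδ]; linarith
  have hη0 : 0 < η' := by rw [hη']; positivity
  have hη1 : η' ≤ 1 := by rw [hη']; nlinarith
  refine ⟨705 / (δ ^ 3 * δ * η'), 6 / δ, by positivity, by positivity, ?_⟩
  intro V _ G _ hcrit hmin hmax
  classical
  obtain ⟨hconn, hchi, hdel⟩ := hcrit
  have hδD : 6 ≤ δ * G.maxDegree := by
    rw [div_le_iff₀ hδ0] at hmax; linarith
  have hDpos : 0 < G.maxDegree := by
    rcases Nat.eq_zero_or_pos G.maxDegree with e | e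
    · rw [e] at hδD; norm_num at hδD
    · exact e
  have hN : Crit.NC G G.maxDegree := Crit.NC_of_lt (by omega)
  obtain ⟨I, hI, hIc⟩ := Crit.indepNum_attained G
  have hpos : ∀ v, 0 < G.degree v := by
    intro v
    have h1 := hmin v
    have h2 : (0:ℝ) < 705 / (δ ^ 3 * δ * η') := by positivity
    exact_mod_cast lt_of_lt_of_le h2 h1
  have main := Crit.discharge (G := G) (D := G.maxDegree) (fun v => G.degree_le_maxDegree v) hpos
    hDpos I hI hδ1 hδ0 hη0 _ rfl (by
      intro x hx y hxy hq
      obtain ⟨φ, hφ, hF, h0⟩ := Crit.exists_PC (by omega)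
        (hdel s(x, y) ((SimpleGraph.mem_edgeSet G).2 hxy))
      refine Crit.key hN hφ hF hxy h0 (G.degree_le_maxDegree y) _ ?_ hx hδ0 hδ1.le hδ0 hδ1.le hη0
        hη1 hδD (fun v hv => (mem_filter.1 hv).2) ?_ hq
      · intro u hu v hv
        exact hI u (mem_filter.1 hu).1 v (mem_filter.1 hv).1
      · have := hmin x
        rw [div_le_iff₀ (by positivity)] at this
        linarith)
  have hconst : 1 / (1 - δ) + (δ + 2 * η' / δ) ≤ 1 + ε := by
    have h1 : 1 / (1 - δ) ≤ 1 + ε / 2 := by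
      rw [div_le_iff₀ (by linarith), hδ]
      nlinarith
    have h2 : 2 * η' / δ = ε / 4 := by
      rw [hδ, hη']; field_simp; norm_num
    linarith
  have hcard : (I.card : ℝ) + (Iᶜ).card = Fintype.card V := by
    exact_mod_cast Finset.card_add_card_compl I
  have hn : (0:ℝ) < Fintype.card V := by
    have := hconn.nonempty
    exact_mod_cast Fintype.card_pos
  have h1 : (I.card : ℝ) ≤ (1 + ε) * (Iᶜ).card :=
    main.trans (mul_le_mul_of_nonneg_right hconst (Nat.cast_nonneg _))
  rw [← hIc]
  by_contra hcon
  rw [not_lt] at hcon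
  have h2 : (2 + ε) * I.card ≤ (1 + ε) * Fintype.card V := by
    rw [← hcard]; linarith
  have h3 : (2 + ε) * ((1 / 2 + ε) * Fintype.card V) ≤ (2 + ε) * I.card := by gcongr
  nlinarith [mul_pos hε0 hn, mul_pos (mul_pos hε0 hε0) hn]
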